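/- There exist constants C > 0 and θ ∈ (0,1) such that for every function g : [0,1] → ℝ of bounded total variation and every n ≥ 1, Var_{[0,1]}(ℒⁿg − f_μ·∫₀¹ g(t) dt) + ‖ℒⁿg − f_μ·∫₀¹ g(t) dt‖_{L¹} ≤ C θⁿ (Var_{[0,1]}(g) + ‖g‖_{L¹}); that is, the transfer operator ℒ of the SCF map has a spectral gap, with 1 a simple dominant eigenvalue and eigenfunction f_μ. -/

import Mathlib

open MeasureTheory Real Set Filter Topology

namespace SCF

/-- The involution `ι(x) = (1−x)/(1+x)`. -/
noncomputable def iota (x : ℝ) : ℝ := (1 - x) / (1 + x)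

/-- Even continued-fraction step.  For `y ∈ (0,1/2]` one has
`⌊(1/y+1)/2⌋ = k` whenever `1/y ∈ (2k−1, 2k+1)`, so `Te y = |1/y − 2k|`;
explicitly `Te y = 1/y − 2` on `[1/3,1/2]`, `Te y = 1/y − 2k` on
`[1/(2k+1), 1/(2k))` and `Te y = 2k − 1/y` on `[1/(2k), 1/(2k−1))` (`k ≥ 2`). -/
noncomputable def Te (y : ℝ) : ℝ := |1 / y - 2 * (⌊(1 / y + 1) / 2⌋ : ℝ)|

/-- The spliced continued fraction (SCF) map `T : [0,1] → [0,1]`, with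
`T 0 = 0`, `T 1 = 1`.  On `(0,1/2]` it is the even continued fraction map
(see `Te`), and on `(1/2,1)` it is the odd–odd map, which is the conjugate
`ι ∘ Te ∘ ι` of the even map; this agrees with the branchwise definition:
`T x = (k x − (k−1))/(k − (k+1) x)` on `((k−1)/k, (2k−1)/(2k+1)]` and
`T x = (k − (k+1) x)/(k x − (k−1))` on `((2k−1)/(2k+1), k/(k+1)]` for `k ≥ 2`. -/
noncomputable def T (x : ℝ) : ℝ :=
  if x ≤ 0 then 0
  else if 1 ≤ x then 1
  else if x ≤ 1 / 2 then Te x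
  else iota (Te (iota x))

/-- Parity label of a digit: `e` (even cusp) or `o` (odd–odd cusp). -/
inductive Par | e | o
deriving DecidableEq

/-- A candidate SCF digit `(a, ε)_s`. -/
structure Digit where
  a : ℤ
  eps : ℤ
  s : Par
deriving DecidableEq

/-- The digit set `𝒜 = {(k,ε)_s : k ≥ 2, ε = ±1, s ∈ {e,o}} ∪ {(1,+1)_e}`. -/
def Digit.Valid (d : Digit) : Prop :=
  (2 ≤ d.a ∧ (d.eps = 1 ∨ d.eps = -1)) ∨ (d.a = 1 ∧ d.eps = 1 ∧ d.s = Par.e)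

/-- The branch intervals `I_{(a,ε)_s}` of the SCF map. -/
noncomputable def branch (d : Digit) : Set ℝ :=
  match d.s with
  | Par.e =>
      if d.a = 1 then Set.Icc (1/3 : ℝ) (1/2)
      else if d.eps = 1 then Set.Ico (1 / (2 * (d.a : ℝ) + 1)) (1 / (2 * (d.a : ℝ)))
      else Set.Ico (1 / (2 * (d.a : ℝ))) (1 / (2 * (d.a : ℝ) - 1))
  | Par.o =>
      if d.eps = 1 then
        Set.Ioc ((2 * (d.a : ℝ) - 1) / (2 * (d.a : ℝ) + 1)) ((d.a : ℝ) / ((d.a : ℝ) + 1))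
      else
        Set.Ioc (((d.a : ℝ) - 1) / (d.a : ℝ)) ((2 * (d.a : ℝ) - 1) / (2 * (d.a : ℝ) + 1))

open Classical in
/-- The SCF digit of a point `y` (the unique valid digit `d` with `y ∈ I_d`;
well defined for every `y ∈ (0,1)`). -/
noncomputable def digit (y : ℝ) : Digit :=
  if h : ∃ d : Digit, d.Valid ∧ y ∈ branch d then h.choose else ⟨1, 1, Par.e⟩

/-- The `n`-th SCF digit `(a_n(x), ε_n(x))_{s_n(x)}` of `x`, `n ≥ 1`,
determined by `T^[n−1] x ∈ I_{(a_n,ε_n)_{s_n}}`. -/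
noncomputable def dig (n : ℕ) (x : ℝ) : Digit := digit (T^[n - 1] x)

/-- The `n`-th SCF partial quotient `a_n(x)`. -/
noncomputable def a (n : ℕ) (x : ℝ) : ℤ := (dig n x).a

/-- The invariant density `f_μ`. -/
noncomputable def fdens (x : ℝ) : ℝ :=
  2 / (Real.log (2 + Real.sqrt 3) * (1 - (2 - Real.sqrt 3) * x) * (1 + Real.sqrt 3 * x))

/-- The absolutely continuous `T`-invariant probability measure `μ` on `(0,1)`. -/
noncomputable def mu : Measure ℝ :=
  (volume.restrict (Set.Ioo (0 : ℝ) 1)).withDensity fun x => ENNReal.ofReal (fdens x)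

/-- The inverse branches `h_{(a,ε)_s}` of the SCF map `T`. -/
noncomputable def h (d : Digit) (x : ℝ) : ℝ :=
  match d.s with
  | Par.e => 1 / (2 * (d.a : ℝ) + (d.eps : ℝ) * x)
  | Par.o =>
      if d.eps = 1 then (((d.a : ℝ) - 1) * x + (d.a : ℝ)) / ((d.a : ℝ) * x + ((d.a : ℝ) + 1))
      else ((d.a : ℝ) * x + ((d.a : ℝ) - 1)) / (((d.a : ℝ) + 1) * x + (d.a : ℝ))

/-- Composed inverse branch `h_{A^{(n)}} = h_{A₁} ∘ ⋯ ∘ h_{A_n}` of a word. -/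
noncomputable def hWord (l : List Digit) : ℝ → ℝ :=
  l.foldr (fun d g => h d ∘ g) id

/-- The dual inverse branches `bar h_{(b,η)_t}`. -/
noncomputable def hbar (d : Digit) (y : ℝ) : ℝ :=
  match d.s with
  | Par.e => (d.eps : ℝ) / (2 * (d.a : ℝ) + y)
  | Par.o =>
      1 / (1 + (d.eps : ℝ) / (((d.a : ℝ) - ((max 0 d.eps : ℤ) : ℝ)) + 1 / (1 + y)))

/-- The matrix `M_{(a,ε)_s}` associated with the inverse branch `h_{(a,ε)_s}`. -/
noncomputable def Mdig (d : Digit) : Matrix (Fin 2) (Fin 2) ℝ :=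
  match d.s with
  | Par.e => !![0, 1; (d.eps : ℝ), 2 * (d.a : ℝ)]
  | Par.o =>
      !![(d.a : ℝ) - ((max 0 d.eps : ℤ) : ℝ), (d.a : ℝ) - ((max 0 d.eps : ℤ) : ℝ) + (d.eps : ℝ);
         (d.a : ℝ) - ((max 0 d.eps : ℤ) : ℝ) + 1, (d.a : ℝ) - ((max 0 d.eps : ℤ) : ℝ) + (d.eps : ℝ) + 1]

/-- `M_n(x) = M_{(a₁,ε₁)_{s₁}} ⋯ M_{(a_n,ε_n)_{s_n}}`. -/
noncomputable def Mn (n : ℕ) (x : ℝ) : Matrix (Fin 2) (Fin 2) ℝ :=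
  ((List.range n).map fun i => Mdig (digit (T^[i] x))).prod

/-- `P_n(x)`: the `(1,2)`-entry of `M_n(x)` (numerator of the `n`-th convergent). -/
noncomputable def Pc (n : ℕ) (x : ℝ) : ℝ := Mn n x 0 1

/-- `Q_n(x)`: the `(2,2)`-entry of `M_n(x)` (denominator of the `n`-th convergent). -/
noncomputable def Qc (n : ℕ) (x : ℝ) : ℝ := Mn n x 1 1


/-- The transfer operator `ℒ g (x) = Σ_{A ∈ 𝒜} |h_A'(x)| g(h_A x)` of the SCF map. -/
noncomputable def transferOp (g : ℝ → ℝ) : ℝ → ℝ :=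
  fun x => ∑' d : {d : Digit // d.Valid}, |deriv (h d.1) x| * g (h d.1 x)

/-- The function `g` has variation at most `V` on `[0,1]`. -/
def VarLe (g : ℝ → ℝ) (V : ℝ) : Prop :=
  0 ≤ V ∧ eVariationOn g (Icc (0:ℝ) 1) ≤ ENNReal.ofReal V

theorem varLe_iff {g : ℝ → ℝ} {V : ℝ} : VarLe g V ↔ 0 ≤ V ∧
    ∀ (n : ℕ) (x : ℕ → ℝ), Monotone x → (∀ i, x i ∈ Icc (0:ℝ) 1) →
      ∑ i ∈ Finset.range n, |g (x (i+1)) - g (x i)| ≤ V := by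
  have key : ∀ (n : ℕ) (x : ℕ → ℝ), ∑ i ∈ Finset.range n, edist (g (x (i+1))) (g (x i))
      = ENNReal.ofReal (∑ i ∈ Finset.range n, |g (x (i+1)) - g (x i)|) := by
    intro n x
    rw [ENNReal.ofReal_sum_of_nonneg (fun _ _ => abs_nonneg _)]
    refine Finset.sum_congr rfl fun i _ => ?_
    rw [edist_dist, Real.dist_eq]
  unfold VarLe
  refine and_congr_right fun hV => ⟨fun H n x hx hm => ?_, fun H => ?_⟩
  · have := (eVariationOn.sum_le (f := g) (n := n) hx hm).trans H
    rw [key] at this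
    exact (ENNReal.ofReal_le_ofReal_iff hV).1 this
  · refine iSup_le ?_
    rintro ⟨n, x, hx, hm⟩
    rw [key]
    exact ENNReal.ofReal_le_ofReal (H n x hx hm)

theorem VarLe.nonneg {g : ℝ → ℝ} {V : ℝ} (h : VarLe g V) : 0 ≤ V := h.1

theorem VarLe.toReal_le {g : ℝ → ℝ} {V : ℝ} (h : VarLe g V) :
    (eVariationOn g (Icc (0:ℝ) 1)).toReal ≤ V :=
  ENNReal.toReal_le_of_le_ofReal h.1 h.2

theorem VarLe.of_bv {g : ℝ → ℝ} (h : BoundedVariationOn g (Icc (0:ℝ) 1)) :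
    VarLe g (eVariationOn g (Icc (0:ℝ) 1)).toReal :=
  ⟨ENNReal.toReal_nonneg, by rw [ENNReal.ofReal_toReal h]⟩

theorem VarLe.bv {g : ℝ → ℝ} {V : ℝ} (h : VarLe g V) : BoundedVariationOn g (Icc (0:ℝ) 1) :=
  ne_top_of_le_ne_top ENNReal.ofReal_ne_top h.2

theorem VarLe.mono {g : ℝ → ℝ} {V W : ℝ} (h : VarLe g V) (hW : V ≤ W) : VarLe g W :=
  ⟨h.1.trans hW, h.2.trans (ENNReal.ofReal_le_ofReal hW)⟩

theorem VarLe.congr {f g : ℝ → ℝ} {V : ℝ} (h : VarLe g V) (hfg : EqOn f g (Icc (0:ℝ) 1)) :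
    VarLe f V :=
  ⟨h.1, by rw [eVariationOn.congr hfg]; exact h.2⟩

theorem VarLe.abs_sub_le {g : ℝ → ℝ} {V : ℝ} (h : VarLe g V) {x y : ℝ}
    (hx : x ∈ Icc (0:ℝ) 1) (hy : y ∈ Icc (0:ℝ) 1) : |g x - g y| ≤ V := by
  have := h.bv.dist_le hx hy
  rw [Real.dist_eq] at this
  exact this.trans h.toReal_le

theorem VarLe.integrableOn {g : ℝ → ℝ} {V : ℝ} (h : VarLe g V) :
    IntegrableOn g (Icc (0:ℝ) 1) := by
  obtain ⟨p, q, hp, hq, hpq⟩ :=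
    h.bv.locallyBoundedVariationOn.exists_monotoneOn_sub_monotoneOn
  rw [hpq]
  exact (hp.integrableOn_isCompact isCompact_Icc).sub (hq.integrableOn_isCompact isCompact_Icc)

theorem VarLe.add {f g : ℝ → ℝ} {V W : ℝ} (hf : VarLe f V) (hg : VarLe g W) :
    VarLe (fun x => f x + g x) (V + W) := by
  rw [varLe_iff] at *
  refine ⟨add_nonneg hf.1 hg.1, fun n x hx hm => ?_⟩
  refine le_trans ?_ (add_le_add (hf.2 n x hx hm) (hg.2 n x hx hm))
  rw [← Finset.sum_add_distrib]
  refine Finset.sum_le_sum fun i _ => ?_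
  have := abs_add_le (f (x (i+1)) - f (x i)) (g (x (i+1)) - g (x i))
  have e : f (x (i+1)) + g (x (i+1)) - (f (x i) + g (x i))
    = (f (x (i+1)) - f (x i)) + (g (x (i+1)) - g (x i)) := by ring
  rw [e]; exact this

theorem VarLe.const_mul {f : ℝ → ℝ} {V : ℝ} (hf : VarLe f V) (c : ℝ) :
    VarLe (fun x => f x * c) (V * |c|) := by
  rw [varLe_iff] at *
  refine ⟨mul_nonneg hf.1 (abs_nonneg _), fun n x hx hm => ?_⟩
  refine le_trans ?_ (mul_le_mul_of_nonneg_right (hf.2 n x hx hm) (abs_nonneg c))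
  rw [Finset.sum_mul]
  refine Finset.sum_le_sum fun i _ => ?_
  rw [← abs_mul, sub_mul]

theorem VarLe.mul {u v : ℝ → ℝ} {U V M S : ℝ} (hu : VarLe u U) (hv : VarLe v V)
    (hM : ∀ x ∈ Icc (0:ℝ) 1, |u x| ≤ M) (hS : ∀ x ∈ Icc (0:ℝ) 1, |v x| ≤ S) :
    VarLe (fun x => u x * v x) (M * V + U * S) := by
  have hM0 : 0 ≤ M := (abs_nonneg _).trans (hM 0 (by simp))
  have hS0 : 0 ≤ S := (abs_nonneg _).trans (hS 0 (by simp))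
  rw [varLe_iff] at *
  refine ⟨add_nonneg (mul_nonneg hM0 hv.1) (mul_nonneg hu.1 hS0), fun n x hx hm => ?_⟩
  refine le_trans ?_ (add_le_add (mul_le_mul_of_nonneg_left (hv.2 n x hx hm) hM0)
    (mul_le_mul_of_nonneg_right (hu.2 n x hx hm) hS0))
  rw [Finset.mul_sum, Finset.sum_mul, ← Finset.sum_add_distrib]
  refine Finset.sum_le_sum fun i _ => ?_
  have e : u (x (i+1)) * v (x (i+1)) - u (x i) * v (x i)
    = u (x (i+1)) * (v (x (i+1)) - v (x i)) + (u (x (i+1)) - u (x i)) * v (x i) := by ring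
  rw [e]
  refine (abs_add_le _ _).trans ?_
  rw [abs_mul, abs_mul]
  exact add_le_add (mul_le_mul_of_nonneg_right (hM _ (hm _)) (abs_nonneg _))
    (mul_le_mul_of_nonneg_left (hS _ (hm _)) (abs_nonneg _))

theorem VarLe.tsum {ι : Type*} {w : ι → ℝ → ℝ} {V : ι → ℝ} (hw : ∀ i, VarLe (w i) (V i))
    (hV : Summable V) (hs : ∀ x ∈ Icc (0:ℝ) 1, Summable fun i => w i x) :
    VarLe (fun x => ∑' i, w i x) (∑' i, V i) := by
  rw [varLe_iff]
  refine ⟨tsum_nonneg fun i => (hw i).1, fun n x hx hm => ?_⟩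
  have hb : ∀ j, ∀ i, ‖w i (x (j+1)) - w i (x j)‖ ≤ V i := fun j i =>
    (hw i).abs_sub_le (hm _) (hm _)
  have hsn : ∀ j, Summable fun i => ‖w i (x (j+1)) - w i (x j)‖ := fun j =>
    Summable.of_nonneg_of_le (fun _ => norm_nonneg _) (hb j) hV
  calc ∑ j ∈ Finset.range n, |∑' i, w i (x (j+1)) - ∑' i, w i (x j)|
      ≤ ∑ j ∈ Finset.range n, ∑' i, ‖w i (x (j+1)) - w i (x j)‖ := by
        refine Finset.sum_le_sum fun j _ => ?_
        rw [← (hs _ (hm _)).tsum_sub (hs _ (hm _))]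
        exact norm_tsum_le_tsum_norm (hsn j)
    _ = ∑' i, ∑ j ∈ Finset.range n, ‖w i (x (j+1)) - w i (x j)‖ :=
        (Summable.tsum_finsetSum fun j _ => hsn j).symm
    _ ≤ ∑' i, V i := by
        refine Summable.tsum_le_tsum (fun i => ((varLe_iff.1 (hw i)).2 n x hx hm))
          (summable_sum fun j _ => hsn j) hV

theorem VarLe.of_monotoneOn {f : ℝ → ℝ} (hf : MonotoneOn f (Icc (0:ℝ) 1)) :
    VarLe f (f 1 - f 0) := by
  refine ⟨sub_nonneg.2 (hf (by simp) (by simp) zero_le_one), ?_⟩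
  have := (hf.eVariationOn_eq (a := 0) (b := 1) (by simp) (by simp)).le
  rwa [inter_self] at this

theorem VarLe.of_antitoneOn {f : ℝ → ℝ} (hf : AntitoneOn f (Icc (0:ℝ) 1)) :
    VarLe f (f 0 - f 1) := by
  have h1 := (VarLe.of_monotoneOn (f := fun x => - f x) hf.neg).const_mul (-1)
  refine (h1.congr fun x _ => by ring).mono ?_
  simp

/-- weighted sup bound -/
theorem sup_bound {u v : ℝ → ℝ} {U V : ℝ} (hu : VarLe u U) (hv : VarLe v V)
    (hu0 : ∀ x ∈ Icc (0:ℝ) 1, 0 ≤ u x)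
    {x : ℝ} (hx : x ∈ Icc (0:ℝ) 1) (hi : IntegrableOn (fun t => u t * |v t|) (Icc (0:ℝ) 1)) :
    |v x| * (∫ t in Icc (0:ℝ) 1, u t) ≤
      (∫ t in Icc (0:ℝ) 1, u t * |v t|) + V * ∫ t in Icc (0:ℝ) 1, u t := by
  rw [← integral_const_mul, ← integral_const_mul,
    ← integral_add hi (hu.integrableOn.const_mul V)]
  refine setIntegral_mono_on (hu.integrableOn.const_mul _) (hi.add (hu.integrableOn.const_mul V))
    measurableSet_Icc fun t ht => ?_
  have h1 := hv.abs_sub_le hx ht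
  have h2 := abs_sub_abs_le_abs_sub (v x) (v t)
  nlinarith [hu0 t ht]

/-- weighted mean oscillation bound with the factor one half -/
theorem half_bound {u v : ℝ → ℝ} {U V m : ℝ} (hu : VarLe u U) (hv : VarLe v V)
    (hu0 : ∀ x ∈ Icc (0:ℝ) 1, 0 ≤ u x)
    (hi : IntegrableOn (fun t => u t * v t) (Icc (0:ℝ) 1))
    (hpos : 0 < ∫ t in Icc (0:ℝ) 1, u t)
    (hm : m * (∫ t in Icc (0:ℝ) 1, u t) = ∫ t in Icc (0:ℝ) 1, u t * v t) :
    ∫ t in Icc (0:ℝ) 1, u t * |v t - m| ≤ (∫ t in Icc (0:ℝ) 1, u t) * V / 2 := by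
  set l := ∫ t in Icc (0:ℝ) 1, u t with hl
  have hbdd : BddBelow (v '' Icc (0:ℝ) 1) := by
    refine ⟨v 0 - V, ?_⟩
    rintro _ ⟨x, hx, rfl⟩
    have := abs_le.1 (hv.abs_sub_le hx (by simp : (0:ℝ) ∈ Icc (0:ℝ) 1))
    linarith
  have hne : (v '' Icc (0:ℝ) 1).Nonempty := ⟨v 0, 0, by simp, rfl⟩
  set α := sInf (v '' Icc (0:ℝ) 1)
  have h1 : ∀ x ∈ Icc (0:ℝ) 1, α ≤ v x := fun x hx => csInf_le hbdd ⟨x, hx, rfl⟩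
  have h2 : ∀ x ∈ Icc (0:ℝ) 1, v x ≤ α + V := by
    intro x hx
    have : v x - V ≤ α := by
      refine le_csInf hne ?_
      rintro _ ⟨y, hy, rfl⟩
      have := abs_le.1 (hv.abs_sub_le hx hy)
      linarith
    linarith
  have hil : ∀ c : ℝ, IntegrableOn (fun t => u t * c) (Icc (0:ℝ) 1) := fun c =>
    hu.integrableOn.mul_const c
  have hα : α ≤ m := by
    have : α * l ≤ m * l := by
      rw [hm, hl, mul_comm, ← integral_mul_const]
      exact setIntegral_mono_on (hil _) hi measurableSet_Icc fun t ht =>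
        mul_le_mul_of_nonneg_left (h1 t ht) (hu0 t ht)
    exact le_of_mul_le_mul_right this hpos
  have hβ : m ≤ α + V := by
    have : m * l ≤ (α + V) * l := by
      rw [hm, hl, mul_comm (α + V), ← integral_mul_const]
      exact setIntegral_mono_on hi (hil _) measurableSet_Icc fun t ht =>
        mul_le_mul_of_nonneg_left (h2 t ht) (hu0 t ht)
    exact le_of_mul_le_mul_right this hpos
  rcases hv.1.eq_or_lt with h0 | h0
  · have hz : ∫ t in Icc (0:ℝ) 1, u t * |v t - m| = ∫ t in Icc (0:ℝ) 1, (0:ℝ) := by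
      refine setIntegral_congr_fun measurableSet_Icc fun t ht => ?_
      have e : v t - m = 0 := by linarith [h1 t ht, h2 t ht]
      simp [e]
    rw [hz, ← h0]; simp
  have hI : IntegrableOn (fun t => u t * |v t - m|) (Icc (0:ℝ) 1) := by
    have h3 : IntegrableOn (fun t => |u t * v t - u t * m|) (Icc (0:ℝ) 1) := (hi.sub (hil m)).abs
    refine h3.congr_fun (fun t ht => ?_) measurableSet_Icc
    simp only
    rw [← mul_sub, abs_mul, abs_of_nonneg (hu0 t ht)]
  have h4 : V * ∫ t in Icc (0:ℝ) 1, u t * |v t - m| ≤ 2 * ((m - α) * (α + V - m)) * l := by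
    have e : 2 * ((m - α) * (α + V - m)) * l
      = ∫ t in Icc (0:ℝ) 1, (u t * v t * (α + V - m - (m - α))
          + u t * ((m-α) * (α + V) - (α + V - m) * α)) := by
      rw [integral_add (hi.mul_const _) (hil _), integral_mul_const, integral_mul_const, ← hm]
      ring
    rw [e, ← integral_const_mul]
    refine setIntegral_mono_on (hI.const_mul V) ((hi.mul_const _).add (hil _)) measurableSet_Icc
      fun t ht => ?_
    have h5 : V * |v t - m| ≤ (m - α) * (α + V - v t) + (α + V - m) * (v t - α) := by
      rcases abs_cases (v t - m) with ⟨h6, _⟩ | ⟨h6, _⟩ <;> rw [h6] <;>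
        nlinarith [h1 t ht, h2 t ht]
    have h7 := mul_le_mul_of_nonneg_left h5 (hu0 t ht)
    nlinarith
  have h8 : (m - α) * (α + V - m) ≤ V^2/4 := by nlinarith [sq_nonneg (m - α - V/2)]
  have h9 : V * ∫ t in Icc (0:ℝ) 1, u t * |v t - m| ≤ V * (l * V / 2) := by
    nlinarith
  exact le_of_mul_le_mul_left h9 h0

theorem VarLe.norm_sub_const {f : ℝ → ℝ} {V : ℝ} (hf : VarLe f V) (c : ℝ) :
    VarLe (fun x => ‖f x - c‖) V := by
  rw [varLe_iff] at *
  refine ⟨hf.1, fun n x hx hm => le_trans ?_ (hf.2 n x hx hm)⟩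
  refine Finset.sum_le_sum fun i _ => ?_
  have := abs_norm_sub_norm_le (f (x (i+1)) - c) (f (x i) - c)
  rwa [sub_sub_sub_cancel_right] at this

/-- Data of a countable full-branch system with good distortion. -/
structure Sys {ι : Type} (h u : ι → ℝ → ℝ) (l M U : ι → ℝ) : Prop where
  maps : ∀ i, ∀ x ∈ Icc (0:ℝ) 1, h i x ∈ Icc (0:ℝ) 1
  lpos : ∀ i, 0 < l i
  lower : ∀ i, ∀ x ∈ Icc (0:ℝ) 1, 2/5 * l i ≤ u i x
  upper : ∀ i, ∀ x ∈ Icc (0:ℝ) 1, u i x ≤ M i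
  Mle : ∀ i, M i ≤ 5/2 * l i
  var : ∀ i, VarLe (u i) (U i)
  Ule : ∀ i, U i ≤ 21/10 * l i
  good : ∀ i, 3 * l i + M i + U i ≤ 19/20
  int_u : ∀ i, ∫ t in Icc (0:ℝ) 1, u i t = l i
  tile_int : ∀ g : ℝ → ℝ, IntegrableOn g (Icc (0:ℝ) 1) →
    HasSum (fun i => ∫ t in Icc (0:ℝ) 1, u i t * g (h i t)) (∫ t in Icc (0:ℝ) 1, g t)
  tile_var : ∀ (g : ℝ → ℝ) (V : ℝ), VarLe g V →
    ∃ W : ι → ℝ, (∀ i, VarLe (fun x => g (h i x)) (W i)) ∧ Summable W ∧ ∑' i, W i ≤ V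

theorem Sys.summable_l {ι : Type} {h u : ι → ℝ → ℝ} {l M U : ι → ℝ} (S : Sys h u l M U) :
    Summable l := by
  have := (S.tile_int (fun _ => 1) (by simp)).summable
  simpa [S.int_u] using this

theorem Sys.u_nonneg {ι : Type} {h u : ι → ℝ → ℝ} {l M U : ι → ℝ} (S : Sys h u l M U)
    (i : ι) : ∀ x ∈ Icc (0:ℝ) 1, 0 ≤ u i x := fun x hx => by
  have := S.lower i x hx
  have := S.lpos i
  linarith

theorem Sys.abs_u_le {ι : Type} {h u : ι → ℝ → ℝ} {l M U : ι → ℝ} (S : Sys h u l M U)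
    (i : ι) : ∀ x ∈ Icc (0:ℝ) 1, |u i x| ≤ M i := fun x hx => by
  rw [abs_of_nonneg (S.u_nonneg i x hx)]; exact S.upper i x hx

theorem VarLe.bounded {g : ℝ → ℝ} {V : ℝ} (hg : VarLe g V) :
    ∃ B, 0 ≤ B ∧ ∀ x ∈ Icc (0:ℝ) 1, |g x| ≤ B := by
  refine ⟨|g 0| + V, add_nonneg (abs_nonneg _) hg.1, fun x hx => ?_⟩
  have := hg.abs_sub_le hx (by simp : (0:ℝ) ∈ Icc (0:ℝ) 1)
  have := abs_sub_abs_le_abs_sub (g x) (g 0)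
  linarith

theorem Sys.bound_term {ι : Type} {h u : ι → ℝ → ℝ} {l M U : ι → ℝ} (S : Sys h u l M U)
    {g : ℝ → ℝ} {B : ℝ} (hB : ∀ x ∈ Icc (0:ℝ) 1, |g x| ≤ B) (i : ι) :
    ∀ x ∈ Icc (0:ℝ) 1, ‖u i x * g (h i x)‖ ≤ 5/2 * l i * B := by
  intro x hx
  rw [norm_mul]
  exact mul_le_mul ((S.abs_u_le i x hx).trans (S.Mle i)) (hB _ (S.maps i x hx)) (norm_nonneg _)
    (by have := S.lpos i; positivity)

theorem Sys.summable_pt {ι : Type} {h u : ι → ℝ → ℝ} {l M U : ι → ℝ} (S : Sys h u l M U)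
    {g : ℝ → ℝ} {V : ℝ} (hg : VarLe g V) : ∀ x ∈ Icc (0:ℝ) 1,
    Summable fun i => u i x * g (h i x) := by
  intro x hx
  obtain ⟨B, _, hB⟩ := hg.bounded
  exact Summable.of_norm_bounded ((S.summable_l.mul_left (5/2)).mul_right B)
    fun i => S.bound_term hB i x hx

theorem Sys.int_L {ι : Type} [Countable ι] {h u : ι → ℝ → ℝ} {l M U : ι → ℝ}
    (S : Sys h u l M U) {g : ℝ → ℝ} {V : ℝ} (hg : VarLe g V) :
    ∫ x in Icc (0:ℝ) 1, (∑' i, u i x * g (h i x)) = ∫ x in Icc (0:ℝ) 1, g x := by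
  obtain ⟨B, hB0, hB⟩ := hg.bounded
  obtain ⟨W, hW, -, -⟩ := S.tile_var g V hg
  have hb : ∀ i x, x ∈ Icc (0:ℝ) 1 → |g (h i x)| ≤ B := fun i x hx => hB _ (S.maps i x hx)
  have hI : ∀ i, IntegrableOn (fun x => u i x * g (h i x)) (Icc (0:ℝ) 1) := fun i =>
    ((S.var i).mul (hW i) (S.abs_u_le i) (hb i)).integrableOn
  have hs : Summable fun i => ∫ x in Icc (0:ℝ) 1, ‖u i x * g (h i x)‖ := by
    refine Summable.of_nonneg_of_le (fun i => integral_nonneg fun _ => norm_nonneg _) (fun i => ?_)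
      ((S.summable_l.mul_left (5/2)).mul_right B)
    have := setIntegral_mono_on (hI i).norm (integrableOn_const (by simp)) measurableSet_Icc
      (S.bound_term hB i)
    simpa using this
  exact (hasSum_integral_of_summable_integral_norm hI hs).unique (S.tile_int g hg.integrableOn)

theorem Sys.contract {ι : Type} [Countable ι] {h u : ι → ℝ → ℝ} {l M U : ι → ℝ}
    (S : Sys h u l M U) {g : ℝ → ℝ} {V : ℝ} (hg : VarLe g V)
    (h0 : ∫ x in Icc (0:ℝ) 1, g x = 0) :
    ∃ V', VarLe (fun x => ∑' i, u i x * g (h i x)) V' ∧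
      6 * (∫ x in Icc (0:ℝ) 1, |∑' i, u i x * g (h i x)|) + V' ≤
        19/20 * (6 * (∫ x in Icc (0:ℝ) 1, |g x|) + V) := by
  obtain ⟨B, hB0, hB⟩ := hg.bounded
  obtain ⟨W, hW, hWs, hWV⟩ := S.tile_var g V hg
  have hb : ∀ i x, x ∈ Icc (0:ℝ) 1 → |g (h i x)| ≤ B := fun i x hx => hB _ (S.maps i x hx)
  have hI : ∀ i, IntegrableOn (fun x => u i x * g (h i x)) (Icc (0:ℝ) 1) := fun i =>
    ((S.var i).mul (hW i) (S.abs_u_le i) (hb i)).integrableOn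
  have hIa : ∀ i, IntegrableOn (fun x => u i x * |g (h i x)|) (Icc (0:ℝ) 1) := fun i => by
    refine IntegrableOn.congr_fun (hI i).abs (fun t ht => ?_) measurableSet_Icc
    rw [abs_mul, abs_of_nonneg (S.u_nonneg i t ht)]
  have hn := S.tile_int (fun x => |g x|) hg.integrableOn.abs
  have hw := S.tile_int g hg.integrableOn
  rw [h0] at hw
  set n : ι → ℝ := fun i => ∫ t in Icc (0:ℝ) 1, u i t * |g (h i t)| with hndef
  set w : ι → ℝ := fun i => ∫ t in Icc (0:ℝ) 1, u i t * g (h i t) with hwdef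
  have hn0 : ∀ i, 0 ≤ n i := fun i => setIntegral_nonneg measurableSet_Icc fun t ht =>
    mul_nonneg (S.u_nonneg i t ht) (abs_nonneg _)
  have hwn : ∀ i, |w i| ≤ n i := by
    intro i
    refine (abs_integral_le_integral_abs).trans (le_of_eq ?_)
    refine setIntegral_congr_fun measurableSet_Icc fun t ht => ?_
    rw [abs_mul, abs_of_nonneg (S.u_nonneg i t ht)]
  -- variation of each term
  have hterm : ∀ i, VarLe (fun x => u i x * g (h i x)) ((M i + U i) * W i + 21/10 * n i) := by
    intro i
    have hl := S.lpos i
    have hsup : ∀ x ∈ Icc (0:ℝ) 1, |g (h i x)| ≤ n i / l i + W i := by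
      intro x hx
      have := sup_bound (S.var i) (hW i) (S.u_nonneg i) hx (hIa i)
      rw [S.int_u i] at this
      rw [← mul_le_mul_iff_left₀ hl, add_mul, div_mul_cancel₀ _ hl.ne']
      exact this
    refine ((S.var i).mul (hW i) (S.abs_u_le i) hsup).mono ?_
    have h1 : U i * (n i / l i) ≤ 21/10 * n i := by
      have : U i * (n i / l i) = U i / l i * n i := by ring
      rw [this]
      exact mul_le_mul_of_nonneg_right ((div_le_iff₀ hl).2 (S.Ule i)) (hn0 i)
    nlinarith
  have hsV : Summable fun i => (M i + U i) * W i + 21/10 * n i := by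
    refine Summable.add ?_ (hn.summable.mul_left _)
    refine Summable.of_nonneg_of_le (fun i => ?_) (fun i => ?_) hWs
    · refine mul_nonneg (add_nonneg ?_ (S.var i).1) (hW i).1
      exact (abs_nonneg _).trans (S.abs_u_le i 0 (by simp))
    · have h1 := S.good i
      have h2 := S.lpos i
      have h3 := (hW i).1
      nlinarith
  have hVar := VarLe.tsum hterm hsV (S.summable_pt hg)
  refine ⟨_, hVar, ?_⟩
  -- the `L¹` part
  have hF : ∀ i, IntegrableOn (fun x => u i x * g (h i x) - 2/5 * w i) (Icc (0:ℝ) 1) := fun i =>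
    (hI i).sub (integrableOn_const (by simp))
  have hFb : ∀ i, ∫ x in Icc (0:ℝ) 1, ‖u i x * g (h i x) - 2/5 * w i‖ ≤
      l i * W i / 2 + 3/5 * n i := by
    intro i
    have hl := S.lpos i
    set m := w i / l i with hm
    have hml : m * l i = w i := div_mul_cancel₀ _ hl.ne'
    have hh := half_bound (m := m) (S.var i) (hW i) (S.u_nonneg i) (hI i)
      (by rw [S.int_u i]; exact hl) (by rw [S.int_u i]; exact hml)
    rw [S.int_u i] at hh
    have hI1 : IntegrableOn (fun t => u i t * |g (h i t) - m|) (Icc (0:ℝ) 1) := by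
      refine IntegrableOn.congr_fun ((hI i).sub ((S.var i).integrableOn.mul_const m)).abs
        (fun t ht => ?_) measurableSet_Icc
      simp only [Pi.sub_apply]
      rw [← mul_sub, abs_mul, abs_of_nonneg (S.u_nonneg i t ht)]
    have hI2 : IntegrableOn (fun t => (u i t - 2/5 * l i) * |m|) (Icc (0:ℝ) 1) :=
      ((S.var i).integrableOn.sub (integrableOn_const (by simp))).mul_const _
    have h1 := setIntegral_mono_on (hF i).norm (hI1.add hI2) measurableSet_Icc
      (fun t ht => by
        have e : u i t * g (h i t) - 2/5 * w i =
          u i t * (g (h i t) - m) + (u i t - 2/5 * l i) * m := by rw [← hml]; ring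
        rw [e]
        refine (norm_add_le _ _).trans ?_
        rw [norm_mul, norm_mul, Real.norm_of_nonneg (S.u_nonneg i t ht),
          Real.norm_of_nonneg (sub_nonneg.2 (S.lower i t ht))]
        exact le_rfl)
    refine h1.trans ?_
    rw [integral_add' hI1 hI2]
    refine add_le_add hh ?_
    rw [integral_mul_const, integral_sub (S.var i).integrableOn (integrableOn_const (by simp)),
      S.int_u i]
    have h2 : l i * |m| = |w i| := by rw [← hml, abs_mul, abs_of_pos hl, mul_comm]
    have h3 := hwn i
    simp
    nlinarith
  have hsB : Summable fun i => l i * W i / 2 + 3/5 * n i := by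
    refine Summable.add ?_ (hn.summable.mul_left _)
    refine Summable.of_nonneg_of_le (fun i => ?_) (fun i => ?_) hWs
    · have := S.lpos i; have := (hW i).1; positivity
    · have h1 := S.good i
      have h4 := (S.var i).1
      have h5 := (abs_nonneg _).trans (S.abs_u_le i 0 (by simp))
      have h3 := (hW i).1
      have : l i ≤ 2 := by linarith
      nlinarith
  have hsF : Summable fun i => ∫ x in Icc (0:ℝ) 1, ‖u i x * g (h i x) - 2/5 * w i‖ :=
    Summable.of_nonneg_of_le (fun i => integral_nonneg fun _ => norm_nonneg _) hFb hsB
  have hsum := hasSum_integral_of_summable_integral_norm (F := fun i x =>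
    ‖u i x * g (h i x) - 2/5 * w i‖) (μ := volume.restrict (Icc (0:ℝ) 1))
    (fun i => (hF i).norm) (by simpa using hsF)
  have hptw : ∀ x ∈ Icc (0:ℝ) 1, Summable fun i => ‖u i x * g (h i x) - 2/5 * w i‖ := by
    intro x hx
    refine Summable.norm ?_
    exact (S.summable_pt hg x hx).sub (hw.summable.mul_left _)
  have hL1 : ∫ x in Icc (0:ℝ) 1, |∑' i, u i x * g (h i x)| ≤
      ∑' i, (l i * W i / 2 + 3/5 * n i) := by
    have hle : ∫ x in Icc (0:ℝ) 1, |∑' i, u i x * g (h i x)| ≤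
        ∫ x in Icc (0:ℝ) 1, ∑' i, ‖u i x * g (h i x) - 2/5 * w i‖ := by
      refine setIntegral_mono_on hVar.integrableOn.abs ?_ measurableSet_Icc fun x hx => ?_
      · exact (VarLe.tsum (fun i => (hterm i).norm_sub_const (2/5 * w i)) hsV hptw).integrableOn
      · have e : ∑' i, u i x * g (h i x) = ∑' i, (u i x * g (h i x) - 2/5 * w i) := by
          rw [(S.summable_pt hg x hx).tsum_sub (hw.summable.mul_left _), tsum_mul_left, hw.tsum_eq]
          simp
        rw [e]
        exact norm_tsum_le_tsum_norm (hptw x hx)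
    rw [← hsum.tsum_eq] at hle
    exact hle.trans (Summable.tsum_le_tsum hFb hsF hsB)
  calc _ ≤ 6 * (∑' i, (l i * W i / 2 + 3/5 * n i)) + ∑' i, ((M i + U i) * W i + 21/10 * n i) := by
        linarith
    _ = ∑' i, (6 * (l i * W i / 2 + 3/5 * n i) + ((M i + U i) * W i + 21/10 * n i)) := by
        rw [(hsB.mul_left 6).tsum_add hsV, tsum_mul_left]
    _ ≤ ∑' i, (19/20 * (6 * n i + W i)) := by
        refine Summable.tsum_le_tsum (fun i => ?_) ((hsB.mul_left 6).add hsV)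
          (((hn.summable.mul_left 6).add hWs).mul_left _)
        have h1 := S.good i
        have h3 := (hW i).1
        nlinarith
    _ = 19/20 * (6 * (∫ x in Icc (0:ℝ) 1, |g x|) + ∑' i, W i) := by
        rw [tsum_mul_left, (hn.summable.mul_left 6).tsum_add hWs, tsum_mul_left, hn.tsum_eq]
    _ ≤ _ := by linarith

theorem arith_bounds {m x : ℝ} (hm : 2 ≤ m) (hx : 3 ≤ x) (hmx : m ≤ x) (hxm : x ≤ 5/2 * m) :
    2/5 * (1/(m*x)) ≤ 1/x^2 ∧ 1/m^2 ≤ 5/2 * (1/(m*x)) ∧ 1/m^2 - 1/x^2 ≤ 21/10 * (1/(m*x)) ∧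
      3 * (1/(m*x)) + 1/m^2 + (1/m^2 - 1/x^2) ≤ 19/20 := by
  have hm0 : 0 < m := by linarith
  have hx0 : 0 < x := by linarith
  have e1 : 1/(m*x) = (1/m) * (1/x) := by field_simp
  have e2 : 1/m^2 = (1/m)^2 := by field_simp
  have e3 : 1/x^2 = (1/x)^2 := by field_simp
  have a1 : 1/m ≤ 1/2 := one_div_le_one_div_of_le (by norm_num) hm
  have a2 : 1/x ≤ 1/3 := one_div_le_one_div_of_le (by norm_num) hx
  have a3 : 1/x ≤ 1/m := one_div_le_one_div_of_le hm0 hmx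
  have a4 : 2/5 * (1/m) ≤ 1/x := by
    rw [div_mul_div_comm, div_le_div_iff₀ (by positivity) hx0]; linarith
  have a5 : 0 < 1/m := by positivity
  have a6 : 0 < 1/x := by positivity
  rw [e1, e2, e3]
  generalize 1/m = α at *
  generalize 1/x = β at *
  refine ⟨by nlinarith, by nlinarith, by nlinarith, by nlinarith⟩

/-- All the per-branch information for a full Möbius branch onto `[lo, hi]`. -/
structure Branch (φ : ℝ → ℝ) (lo hi : ℝ) : Prop where
  maps : ∀ x ∈ Icc (0:ℝ) 1, φ x ∈ Icc lo hi
  var : ∀ g : ℝ → ℝ, eVariationOn (fun x => g (φ x)) (Icc (0:ℝ) 1) = eVariationOn g (Icc lo hi)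
  int : ∀ g : ℝ → ℝ, ∫ x in Icc (0:ℝ) 1, |deriv φ x| * g (φ x) = ∫ x in Icc lo hi, g x
  bounds : ∃ l M U : ℝ, 0 < l ∧ (∀ x ∈ Icc (0:ℝ) 1, 2/5 * l ≤ |deriv φ x|) ∧
    (∀ x ∈ Icc (0:ℝ) 1, |deriv φ x| ≤ M) ∧ M ≤ 5/2 * l ∧
    VarLe (fun x => |deriv φ x|) U ∧ U ≤ 21/10 * l ∧ 3 * l + M + U ≤ 19/20 ∧
    ∫ x in Icc (0:ℝ) 1, |deriv φ x| = l

theorem mob_deriv {φ : ℝ → ℝ} {p q r s : ℝ} (hφ : ∀ x, φ x = (p*x+q)/(r*x+s))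
    (hdet : |p*s-q*r| = 1) {x : ℝ} (hx : r*x+s ≠ 0) : |deriv φ x| = 1/(r*x+s)^2 := by
  have hd : HasDerivAt φ ((p*s-q*r)/(r*x+s)^2) x := by
    have h1 : HasDerivAt (fun x => p*x+q) p x := by
      simpa using ((hasDerivAt_id x).const_mul p).add_const q
    have h2 : HasDerivAt (fun x => r*x+s) r x := by
      simpa using ((hasDerivAt_id x).const_mul r).add_const s
    have h3 := h1.div h2 hx
    have e : φ = (fun x => p*x+q) / (fun x => r*x+s) := by
      funext y; simp [hφ]
    have e2 : p*s-q*r = p*(r*x+s)-(p*x+q)*r := by ring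
    rw [e, e2]
    exact h3
  rw [hd.deriv, abs_div, hdet, abs_of_nonneg (sq_nonneg _)]

theorem den_pos {r s x : ℝ} (hs : 0 < s) (ht : 0 < r + s) (hx : x ∈ Icc (0:ℝ) 1) :
    0 < r*x+s := by
  rcases le_total 0 r with h | h
  · have := mul_nonneg h hx.1; linarith
  · nlinarith [hx.2]

theorem mob_branch {φ : ℝ → ℝ} {p q r s lo hi : ℝ} (hφ : ∀ x, φ x = (p*x+q)/(r*x+s))
    (hdet : p*s-q*r = 1 ∨ p*s-q*r = -1) 
    (hs2 : 2 ≤ s) (ht2 : 2 ≤ r+s) (h3 : 3 ≤ s ∨ 3 ≤ r+s) (hr1 : s ≤ 5/2 * (r+s))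
    (hr2 : r+s ≤ 5/2*s)
    (hlo : lo ≤ hi) (hlh : (φ 0 = lo ∧ φ 1 = hi) ∨ (φ 0 = hi ∧ φ 1 = lo)) :
    Branch φ lo hi := by
  have hs : 0 < s := by linarith
  have ht : 0 < r+s := by linarith
  have hdet' : |p*s-q*r| = 1 := by rcases hdet with h | h <;> rw [h] <;> simp
  have hD : ∀ x ∈ Icc (0:ℝ) 1, 0 < r*x+s := fun x hx => den_pos hs ht hx
  have hder : ∀ x ∈ Icc (0:ℝ) 1, |deriv φ x| = 1/(r*x+s)^2 := fun x hx =>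
    mob_deriv hφ hdet' (hD x hx).ne'
  have hdiff : ∀ x ∈ Icc (0:ℝ) 1, HasDerivAt φ (deriv φ x) x := by
    intro x hx
    refine DifferentiableAt.hasDerivAt (differentiableAt_of_deriv_ne_zero ?_)
    intro h0
    have := hder x hx
    rw [h0, abs_zero] at this
    have h4 := hD x hx
    have : 0 < 1/(r*x+s)^2 := by positivity
    linarith
  have hcont : ContinuousOn φ (Icc (0:ℝ) 1) := fun x hx =>
    (hdiff x hx).continuousAt.continuousWithinAt
  have hsub : ∀ x ∈ Icc (0:ℝ) 1, ∀ y ∈ Icc (0:ℝ) 1,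
      φ y - φ x = (p*s-q*r) * ((y - x)/((r*x+s)*(r*y+s))) := by
    intro x hx y hy
    have h1 := (hD x hx).ne'
    have h2 := (hD y hy).ne'
    rw [hφ, hφ, div_sub_div _ _ h2 h1, ← mul_div_assoc,
      div_eq_div_iff (mul_ne_zero h2 h1) (mul_ne_zero h1 h2)]
    ring
  have hq : ∀ x ∈ Icc (0:ℝ) 1, ∀ y ∈ Icc (0:ℝ) 1, x < y → 0 < (y - x)/((r*x+s)*(r*y+s)) :=
    fun x hx y hy hxy => div_pos (by linarith) (mul_pos (hD x hx) (hD y hy))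
  have hmono : (StrictMonoOn φ (Icc (0:ℝ) 1)) ∨ (StrictAntiOn φ (Icc (0:ℝ) 1)) := by
    rcases hdet with h | h
    · left
      intro x hx y hy hxy
      have h5 := hsub x hx y hy
      rw [h] at h5
      have := hq x hx y hy hxy
      linarith
    · right
      intro x hx y hy hxy
      have h5 := hsub x hx y hy
      rw [h] at h5
      have := hq x hx y hy hxy
      linarith
  have himg : φ '' Icc (0:ℝ) 1 = Icc lo hi := by
    rcases hmono with hm | hm
    · rw [hcont.image_Icc_of_monotoneOn zero_le_one hm.monotoneOn]
      rcases hlh with ⟨h1, h2⟩ | ⟨h1, h2⟩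
      · rw [h1, h2]
      · have := hm (by simp : (0:ℝ) ∈ Icc (0:ℝ) 1) (by simp : (1:ℝ) ∈ Icc (0:ℝ) 1) zero_lt_one
        linarith
    · rw [hcont.image_Icc_of_antitoneOn zero_le_one hm.antitoneOn]
      rcases hlh with ⟨h1, h2⟩ | ⟨h1, h2⟩
      · have := hm (by simp : (0:ℝ) ∈ Icc (0:ℝ) 1) (by simp : (1:ℝ) ∈ Icc (0:ℝ) 1) zero_lt_one
        linarith
      · rw [h1, h2]
  have hinj : InjOn φ (Icc (0:ℝ) 1) := by
    rcases hmono with hm | hm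
    · exact hm.injOn
    · exact hm.injOn
  have hIntg : ∀ g : ℝ → ℝ, ∫ x in Icc (0:ℝ) 1, |deriv φ x| * g (φ x) = ∫ x in Icc lo hi, g x := by
    intro g
    rw [← himg, integral_image_eq_integral_abs_deriv_smul measurableSet_Icc
      (fun x hx => (hdiff x hx).hasDerivWithinAt) hinj]
    rfl
  refine ⟨fun x hx => himg ▸ mem_image_of_mem φ hx, fun g => ?_, hIntg, ?_⟩
  · rw [← himg]
    rcases hmono with hm | hm
    · exact eVariationOn.comp_eq_of_monotoneOn g φ hm.monotoneOn
    · exact eVariationOn.comp_eq_of_antitoneOn g φ hm.antitoneOn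
  have hl : ∫ x in Icc (0:ℝ) 1, |deriv φ x| = 1/(s*(r+s)) := by
    have h1 := hIntg (fun _ => 1)
    simp only [mul_one] at h1
    rw [h1]
    simp only [integral_const, smul_eq_mul, mul_one, MeasurableSet.univ, measureReal_restrict_apply,
      univ_inter, Real.volume_real_Icc_of_le hlo]
    have h2 := hsub 0 (by simp) 1 (by simp)
    simp only [mul_zero, zero_add, sub_zero, mul_one] at h2
    have h4 : 0 < 1/(s*(r+s)) := by positivity
    rcases hdet with h | h <;> rw [h] at h2 <;> rcases hlh with ⟨h5, h6⟩ | ⟨h5, h6⟩ <;>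
      rw [h5, h6] at h2 <;> linarith
  rcases le_total 0 r with hr | hr
  · have hb := arith_bounds (m := s) (x := r+s) hs2 (by rcases h3 with h | h <;> linarith)
      (by linarith) hr2
    obtain ⟨b1, b2, b3, b4⟩ := hb
    refine ⟨1/(s*(r+s)), 1/s^2, 1/s^2 - 1/(r+s)^2, by positivity, ?_, ?_, b2, ?_, b3, b4, hl⟩
    · intro x hx
      rw [hder x hx]
      refine b1.trans (one_div_le_one_div_of_le (pow_pos (hD x hx) 2) ?_)
      have := hD x hx
      gcongr
      nlinarith [hx.2]
    · intro x hx
      rw [hder x hx]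
      refine one_div_le_one_div_of_le (by positivity) ?_
      gcongr
      nlinarith [hx.1]
    · have ha : AntitoneOn (fun x => 1/(r*x+s)^2) (Icc (0:ℝ) 1) := by
        intro x hx y hy hxy
        refine one_div_le_one_div_of_le (pow_pos (hD x hx) 2) ?_
        have := hD x hx
        gcongr
      have h5 := (VarLe.of_antitoneOn ha).congr (f := fun x => |deriv φ x|) hder
      simpa using h5
  · have hb := arith_bounds (m := r+s) (x := s) ht2 (by rcases h3 with h | h <;> linarith)
      (by linarith) hr1
    rw [mul_comm (r+s) s] at hb
    obtain ⟨b1, b2, b3, b4⟩ := hb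
    refine ⟨1/(s*(r+s)), 1/(r+s)^2, 1/(r+s)^2 - 1/s^2, by positivity, ?_, ?_, b2, ?_, b3, b4, hl⟩
    · intro x hx
      rw [hder x hx]
      refine b1.trans (one_div_le_one_div_of_le (pow_pos (hD x hx) 2) ?_)
      have := hD x hx
      gcongr
      nlinarith [hx.1]
    · intro x hx
      rw [hder x hx]
      refine one_div_le_one_div_of_le (by positivity) ?_
      gcongr
      nlinarith [hx.2]
    · have ha : MonotoneOn (fun x => 1/(r*x+s)^2) (Icc (0:ℝ) 1) := by
        intro x hx y hy hxy
        refine one_div_le_one_div_of_le (pow_pos (hD y hy) 2) ?_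
        have h6 := hD y hy
        have : r*y ≤ r*x := mul_le_mul_of_nonpos_left hxy hr
        gcongr
      have h5 := (VarLe.of_monotoneOn ha).congr (f := fun x => |deriv φ x|) hder
      simpa using h5

/-- Enumeration of the digits: the left copy of `ℕ` runs through the even cusp digits from
`1/2` towards `0`, the right copy through the odd cusp digits from `1/2` towards `1`. -/
def enum : ℕ ⊕ ℕ → Digit
  | Sum.inl k => if k % 2 = 0 then ⟨(k / 2 : ℕ) + 1, 1, Par.e⟩ else ⟨(k / 2 : ℕ) + 2, -1, Par.e⟩
  | Sum.inr k => if k % 2 = 0 then ⟨(k / 2 : ℕ) + 2, -1, Par.o⟩ else ⟨(k / 2 : ℕ) + 2, 1, Par.o⟩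

theorem enum_l0 (n : ℕ) : enum (Sum.inl (2 * n)) = ⟨(n : ℤ) + 1, 1, Par.e⟩ := by
  simp [enum]

theorem enum_l1 (n : ℕ) : enum (Sum.inl (2 * n + 1)) = ⟨(n : ℤ) + 2, -1, Par.e⟩ := by
  have h1 : (2 * n + 1) % 2 = 1 := by omega
  have h2 : (2 * n + 1) / 2 = n := by omega
  simp only [enum, h1, h2]; simp

theorem enum_r0 (n : ℕ) : enum (Sum.inr (2 * n)) = ⟨(n : ℤ) + 2, -1, Par.o⟩ := by
  simp [enum]

theorem enum_r1 (n : ℕ) : enum (Sum.inr (2 * n + 1)) = ⟨(n : ℤ) + 2, 1, Par.o⟩ := by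
  have h1 : (2 * n + 1) % 2 = 1 := by omega
  have h2 : (2 * n + 1) / 2 = n := by omega
  simp only [enum, h1, h2]; simp

theorem enum_cases {P : ℕ ⊕ ℕ → Prop} (h0 : ∀ n, P (Sum.inl (2 * n)))
    (h1 : ∀ n, P (Sum.inl (2 * n + 1))) (h2 : ∀ n, P (Sum.inr (2 * n)))
    (h3 : ∀ n, P (Sum.inr (2 * n + 1))) : ∀ i, P i := by
  rintro (k | k)
  · rcases Nat.even_or_odd' k with ⟨n, rfl | rfl⟩
    · exact h0 n
    · exact h1 n
  · rcases Nat.even_or_odd' k with ⟨n, rfl | rfl⟩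
    · exact h2 n
    · exact h3 n

theorem enum_valid : ∀ i, (enum i).Valid := by
  refine enum_cases ?_ ?_ ?_ ?_ <;> intro n
  · rw [enum_l0]; unfold Digit.Valid; rcases Nat.eq_zero_or_pos n with h | h
    · right; simp [h]
    · left; simp; omega
  · rw [enum_l1]; left; simp
  · rw [enum_r0]; left; simp
  · rw [enum_r1]; left; simp

theorem enum_inj : Function.Injective enum := by
  refine enum_cases ?_ ?_ ?_ ?_ <;> intro n <;> refine enum_cases ?_ ?_ ?_ ?_ <;> intro m hnm <;>
    simp [enum_l0, enum_l1, enum_r0, enum_r1] at hnm ⊢ <;> omega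

theorem enum_surj (d : Digit) (hd : d.Valid) : ∃ i, enum i = d := by
  obtain ⟨a, eps, s⟩ := d
  unfold Digit.Valid at hd
  simp only at hd
  rcases hd with ⟨h1, h2 | h2⟩ | ⟨h1, h2, h3⟩
  · subst h2
    cases s
    · refine ⟨Sum.inl (2 * (a - 1).toNat), ?_⟩
      rw [enum_l0]; simp; omega
    · refine ⟨Sum.inr (2 * (a - 2).toNat + 1), ?_⟩
      rw [enum_r1]; simp; omega
  · subst h2
    cases s
    · refine ⟨Sum.inl (2 * (a - 2).toNat + 1), ?_⟩
      rw [enum_l1]; simp; omega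
    · refine ⟨Sum.inr (2 * (a - 2).toNat), ?_⟩
      rw [enum_r0]; simp; omega
  · subst h1 h2 h3
    exact ⟨Sum.inl (2 * 0), by rw [enum_l0]; simp⟩

/-- The enumeration as an equivalence. -/
noncomputable def enumEquiv : ℕ ⊕ ℕ ≃ {d : Digit // d.Valid} :=
  Equiv.ofBijective (fun i => ⟨enum i, enum_valid i⟩)
    ⟨fun i j hij => enum_inj (congrArg Subtype.val hij),
     fun d => by
      obtain ⟨i, hi⟩ := enum_surj d.1 d.2
      exact ⟨i, Subtype.ext hi⟩⟩

theorem transferOp_eq (g : ℝ → ℝ) (x : ℝ) :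
    transferOp g x = ∑' i : ℕ ⊕ ℕ, |deriv (h (enum i)) x| * g (h (enum i) x) := by
  unfold transferOp
  rw [← enumEquiv.tsum_eq]
  rfl

/-- endpoints of the branch intervals -/
noncomputable def loI : ℕ ⊕ ℕ → ℝ
  | Sum.inl k => 1 / ((k:ℝ) + 1 + 2)
  | Sum.inr k => 1 - 2 / ((k:ℝ) + 4)

/-- endpoints of the branch intervals -/
noncomputable def hiI : ℕ ⊕ ℕ → ℝ
  | Sum.inl k => 1 / ((k:ℝ) + 2)
  | Sum.inr k => 1 - 2 / ((k:ℝ) + 1 + 4)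

theorem h_l0 (n : ℕ) (x : ℝ) : h (enum (Sum.inl (2 * n))) x = (0*x+1) / (1*x + (2*n+2)) := by
  rw [enum_l0]; simp only [h]; push_cast; congr 1 <;> ring

theorem h_l1 (n : ℕ) (x : ℝ) :
    h (enum (Sum.inl (2 * n + 1))) x = (0*x+1) / ((-1)*x + (2*n+4)) := by
  rw [enum_l1]; simp only [h]; push_cast; congr 1 <;> ring

theorem h_r0 (n : ℕ) (x : ℝ) :
    h (enum (Sum.inr (2 * n))) x = (((n:ℝ)+2)*x+(n+1)) / (((n:ℝ)+3)*x + (n+2)) := by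
  rw [enum_r0]; simp only [h]
  rw [if_neg (by norm_num)]
  push_cast; congr 1 <;> ring

theorem h_r1 (n : ℕ) (x : ℝ) :
    h (enum (Sum.inr (2 * n + 1))) x = (((n:ℝ)+1)*x+(n+2)) / (((n:ℝ)+2)*x + (n+3)) := by
  rw [enum_r1]; simp only [h]
  rw [if_pos (by norm_num)]
  push_cast; congr 1 <;> ring

theorem enum_branch : ∀ i, Branch (h (enum i)) (loI i) (hiI i) := by
  refine enum_cases ?_ ?_ ?_ ?_ <;> intro n <;> have hn : (0:ℝ) ≤ n := Nat.cast_nonneg n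
  · refine mob_branch (h_l0 n) (Or.inr (by ring)) (by linarith) (by linarith) (Or.inr (by linarith))
      (by linarith) (by linarith) ?_ (Or.inr ⟨?_, ?_⟩)
    · simp only [loI, hiI]
      exact one_div_le_one_div_of_le (by positivity) (by linarith)
    · rw [h_l0]; simp only [hiI]; push_cast; congr 1 <;> ring
    · rw [h_l0]; simp only [loI]; push_cast; congr 1 <;> ring
  · refine mob_branch (h_l1 n) (Or.inl (by ring)) (by linarith) (by linarith) (Or.inr (by linarith))
      (by linarith) (by linarith) ?_ (Or.inl ⟨?_, ?_⟩)
    · simp only [loI, hiI]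
      exact one_div_le_one_div_of_le (by positivity) (by linarith)
    · rw [h_l1]; simp only [loI]; push_cast; congr 1 <;> ring
    · rw [h_l1]; simp only [hiI]; push_cast; congr 1 <;> ring
  · refine mob_branch (h_r0 n) (Or.inl (by ring)) (by linarith) (by linarith) (Or.inr (by linarith))
      (by linarith) (by linarith) ?_ (Or.inl ⟨?_, ?_⟩)
    · simp only [loI, hiI]
      gcongr; linarith
    · rw [h_r0]; simp only [loI]; push_cast; field_simp; ring
    · rw [h_r0]; simp only [hiI]; push_cast; field_simp; ring
  · refine mob_branch (h_r1 n) (Or.inr (by ring)) (by linarith) (by linarith) (Or.inr (by linarith))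
      (by linarith) (by linarith) ?_ (Or.inr ⟨?_, ?_⟩)
    · simp only [loI, hiI]
      gcongr; linarith
    · rw [h_r1]; simp only [hiI]; push_cast; field_simp; ring
    · rw [h_r1]; simp only [loI]; push_cast; field_simp; ring

theorem abs_telescope {a : ℕ → ℝ} (ha : Monotone a ∨ Antitone a) (n : ℕ) :
    ∑ k ∈ Finset.range n, |a (k+1) - a k| = |a n - a 0| := by
  rcases ha with h | h
  · rw [abs_of_nonneg (sub_nonneg.2 (h (Nat.zero_le n))), ← Finset.sum_range_sub]
    exact Finset.sum_congr rfl fun k _ => abs_of_nonneg (sub_nonneg.2 (h (Nat.le_succ k)))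
  · rw [abs_of_nonpos (sub_nonpos.2 (h (Nat.zero_le n))), ← Finset.sum_range_sub,
      ← Finset.sum_neg_distrib]
    exact Finset.sum_congr rfl fun k _ => abs_of_nonpos (sub_nonpos.2 (h (Nat.le_succ k)))

theorem tile_seq {E : ℕ → ℝ} {e : ℝ} (hE : Monotone E ∨ Antitone E)
    (hm : ∀ k, E k ∈ Icc (0:ℝ) 1) (hlim : Tendsto E atTop (𝓝 e)) {g : ℝ → ℝ}
    (hg : IntegrableOn g (Icc (0:ℝ) 1)) :
    HasSum (fun k => ∫ x in (E k)..(E (k+1)), g x) (∫ x in (E 0)..e, g x) := by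
  have he : e ∈ Icc (0:ℝ) 1 := isClosed_Icc.mem_of_tendsto hlim (Eventually.of_forall hm)
  have hii : ∀ {f : ℝ → ℝ}, IntegrableOn f (Icc (0:ℝ) 1) → ∀ a ∈ Icc (0:ℝ) 1, ∀ b ∈ Icc (0:ℝ) 1,
      IntervalIntegrable f volume a b := by
    intro f hf a ha b hb
    refine (hf.mono_set ?_).intervalIntegrable
    exact (convex_Icc (0:ℝ) 1).ordConnected.uIcc_subset ha hb
  have h0 : (0:ℝ) ∈ Icc (0:ℝ) 1 := by simp
  have hga := hg.abs
  set F : ℝ → ℝ := fun x => ∫ t in (0:ℝ)..x, |g t| with hF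
  have hFd : ∀ a ∈ Icc (0:ℝ) 1, ∀ b ∈ Icc (0:ℝ) 1, F b - F a = ∫ t in a..b, |g t| := by
    intro a ha b hb
    exact intervalIntegral.integral_interval_sub_left (hii hga 0 h0 b hb) (hii hga 0 h0 a ha)
  have hFm : ∀ a ∈ Icc (0:ℝ) 1, ∀ b ∈ Icc (0:ℝ) 1, a ≤ b → F a ≤ F b := by
    intro a ha b hb hab
    rw [← sub_nonneg, hFd a ha b hb]
    exact intervalIntegral.integral_nonneg hab fun _ _ => abs_nonneg _
  have hFE : Monotone (fun k => F (E k)) ∨ Antitone (fun k => F (E k)) := by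
    rcases hE with h | h
    · exact Or.inl fun i j hij => hFm _ (hm _) _ (hm _) (h hij)
    · exact Or.inr fun i j hij => hFm _ (hm _) _ (hm _) (h hij)
  have hsum : Summable fun k => ∫ x in (E k)..(E (k+1)), g x := by
    refine Summable.of_norm_bounded (g := fun k => |F (E (k+1)) - F (E k)|) ?_ fun k => ?_
    · refine summable_of_sum_range_le (c := F 1) (fun _ => abs_nonneg _) fun n => ?_
      rw [abs_telescope hFE n]
      have a1 := hFm _ (hm n) 1 (by simp) (hm n).2
      have a2 := hFm _ (hm 0) 1 (by simp) (hm 0).2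
      have a3 := hFm 0 h0 _ (hm n) (hm n).1
      have a4 := hFm 0 h0 _ (hm 0) (hm 0).1
      have a5 : F 0 = 0 := by simp [hF]
      rw [abs_le]; constructor <;> linarith
    · rw [hFd _ (hm _) _ (hm _)]
      exact intervalIntegral.norm_integral_le_abs_integral_norm
  rw [hsum.hasSum_iff_tendsto_nat]
  have e1 : ∀ n, ∑ k ∈ Finset.range n, ∫ x in (E k)..(E (k+1)), g x = ∫ x in (E 0)..(E n), g x :=
    fun n => intervalIntegral.sum_integral_adjacent_intervals fun k _ =>
      hii hg _ (hm _) _ (hm _)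
  simp only [e1]
  have hc : ContinuousOn (fun x => ∫ t in (E 0)..x, g t) (uIcc 0 1) :=
    intervalIntegral.continuousOn_primitive_interval' (hii hg 0 h0 1 (by simp))
      (by rw [uIcc_of_le zero_le_one]; exact hm 0)
  rw [uIcc_of_le zero_le_one] at hc
  exact (hc e he).tendsto.comp (tendsto_nhdsWithin_iff.2 ⟨hlim, Eventually.of_forall hm⟩)

theorem HasSum.sum_type {f : ℕ ⊕ ℕ → ℝ} {a b : ℝ} (ha : HasSum (fun k => f (Sum.inl k)) a)
    (hb : HasSum (fun k => f (Sum.inr k)) b) : HasSum f (a + b) := by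
  exact HasSum.sum ha hb

/-- left endpoints sequence -/
noncomputable def El (k : ℕ) : ℝ := 1 / ((k:ℝ) + 2)
/-- right endpoints sequence -/
noncomputable def Er (k : ℕ) : ℝ := 1 - 2 / ((k:ℝ) + 4)

theorem El_anti : Antitone El := by
  intro i j hij
  have : (i:ℝ) ≤ j := by exact_mod_cast hij
  simp only [El]
  gcongr

theorem Er_mono : Monotone Er := by
  intro i j hij
  have : (i:ℝ) ≤ j := by exact_mod_cast hij
  simp only [Er]
  gcongr

theorem El_mem (k : ℕ) : El k ∈ Icc (0:ℝ) 1 := by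
  simp only [El]
  have hk : (0:ℝ) ≤ k := Nat.cast_nonneg k
  refine ⟨by positivity, ?_⟩
  rw [div_le_one (by positivity)]; linarith

theorem Er_mem (k : ℕ) : Er k ∈ Icc (0:ℝ) 1 := by
  simp only [Er]
  have hk : (0:ℝ) ≤ k := Nat.cast_nonneg k
  have h1 : 2 / ((k:ℝ)+4) ≤ 1 := by rw [div_le_one (by positivity)]; linarith
  have h2 : 0 ≤ 2 / ((k:ℝ)+4) := by positivity
  constructor <;> linarith

theorem El_lim : Tendsto El atTop (𝓝 0) := by
  have : Tendsto (fun k : ℕ => 1 / ((k:ℝ) + 2)) atTop (𝓝 0) :=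
    tendsto_const_nhds.div_atTop
      (tendsto_atTop_add_const_right _ _ tendsto_natCast_atTop_atTop)
  exact this

theorem Er_lim : Tendsto Er atTop (𝓝 1) := by
  have h1 : Tendsto (fun k : ℕ => 2 / ((k:ℝ) + 4)) atTop (𝓝 0) :=
    tendsto_const_nhds.div_atTop
      (tendsto_atTop_add_const_right _ _ tendsto_natCast_atTop_atTop)
  have := (tendsto_const_nhds (x := (1:ℝ))).sub h1
  rw [sub_zero] at this
  exact this

theorem Icc_l (k : ℕ) : Icc (loI (Sum.inl k)) (hiI (Sum.inl k)) = Icc (El (k+1)) (El k) := by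
  simp only [loI, hiI, El]; push_cast; rfl

theorem Icc_r (k : ℕ) : Icc (loI (Sum.inr k)) (hiI (Sum.inr k)) = Icc (Er k) (Er (k+1)) := by
  simp only [loI, hiI, Er]; push_cast; rfl

theorem tile_int_all {g : ℝ → ℝ} (hg : IntegrableOn g (Icc (0:ℝ) 1)) :
    HasSum (fun i => ∫ x in Icc (loI i) (hiI i), g x) (∫ x in Icc (0:ℝ) 1, g x) := by
  have hl : HasSum (fun k => ∫ x in Icc (loI (Sum.inl k)) (hiI (Sum.inl k)), g x)
      (∫ x in (0:ℝ)..(1/2), g x) := by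
    have := (tile_seq (Or.inr El_anti) El_mem El_lim hg).neg
    rw [← intervalIntegral.integral_symm] at this
    have e : El 0 = 1/2 := by simp [El]
    rw [e] at this
    have e2 : (fun k => ∫ x in Icc (loI (Sum.inl k)) (hiI (Sum.inl k)), g x) =
        fun k => -∫ x in (El k)..(El (k+1)), g x := funext fun k => by
      rw [Icc_l, ← intervalIntegral.integral_symm, intervalIntegral.integral_of_le
        (El_anti (Nat.le_succ k)), integral_Icc_eq_integral_Ioc]
    rw [e2]
    exact this
  have hr : HasSum (fun k => ∫ x in Icc (loI (Sum.inr k)) (hiI (Sum.inr k)), g x)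
      (∫ x in (1/2:ℝ)..1, g x) := by
    have := (tile_seq (Or.inl Er_mono) Er_mem Er_lim hg)
    have e : Er 0 = 1/2 := by simp [Er]; norm_num
    rw [e] at this
    have e2 : (fun k => ∫ x in Icc (loI (Sum.inr k)) (hiI (Sum.inr k)), g x) =
        fun k => ∫ x in (Er k)..(Er (k+1)), g x := funext fun k => by
      rw [Icc_r, intervalIntegral.integral_of_le
        (Er_mono (Nat.le_succ k)), integral_Icc_eq_integral_Ioc]
    rw [e2]
    exact this
  have := HasSum.sum_type (f := fun i => ∫ x in Icc (loI i) (hiI i), g x) hl hr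
  rw [intervalIntegral.integral_add_adjacent_intervals,
    intervalIntegral.integral_of_le zero_le_one, ← integral_Icc_eq_integral_Ioc] at this
  · exact this
  · refine (hg.mono_set ?_).intervalIntegrable
    rw [uIcc_of_le (by norm_num)]; exact Icc_subset_Icc_right (by norm_num)
  · refine (hg.mono_set ?_).intervalIntegrable
    rw [uIcc_of_le (by norm_num)]; exact Icc_subset_Icc_left (by norm_num)

theorem evar_split (g : ℝ → ℝ) {a b c : ℝ} (hab : a ≤ b) (hbc : b ≤ c) :
    eVariationOn g (Icc a b) + eVariationOn g (Icc b c) = eVariationOn g (Icc a c) := by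
  have := eVariationOn.Icc_add_Icc g (s := univ) hab hbc (mem_univ _)
  simpa using this

theorem tile_var_all (g : ℝ → ℝ) :
    ∑' i, eVariationOn g (Icc (loI i) (hiI i)) ≤ eVariationOn g (Icc (0:ℝ) 1) := by
  have hl : ∑' k, eVariationOn g (Icc (loI (Sum.inl k)) (hiI (Sum.inl k))) ≤
      eVariationOn g (Icc (0:ℝ) (1/2)) := by
    refine ENNReal.tsum_le_of_sum_range_le fun n => ?_
    have e : ∑ k ∈ Finset.range n, eVariationOn g (Icc (loI (Sum.inl k)) (hiI (Sum.inl k)))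
        = eVariationOn g (Icc (El n) (El 0)) := by
      induction n with
      | zero => simp
      | succ n ih =>
        rw [Finset.sum_range_succ, ih, Icc_l, add_comm,
          evar_split g (El_anti (Nat.le_succ n)) (El_anti (Nat.zero_le n))]
    rw [e]
    refine eVariationOn.mono _ (Icc_subset_Icc (El_mem n).1 ?_)
    simp [El]
  have hr : ∑' k, eVariationOn g (Icc (loI (Sum.inr k)) (hiI (Sum.inr k))) ≤
      eVariationOn g (Icc (1/2:ℝ) 1) := by
    refine ENNReal.tsum_le_of_sum_range_le fun n => ?_
    have e : ∑ k ∈ Finset.range n, eVariationOn g (Icc (loI (Sum.inr k)) (hiI (Sum.inr k)))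
        = eVariationOn g (Icc (Er 0) (Er n)) := by
      rw [← eVariationOn.sum' g Er_mono]
      exact Finset.sum_congr rfl fun k _ => by rw [Icc_r]
    rw [e]
    refine eVariationOn.mono _ (Icc_subset_Icc ?_ (Er_mem n).2)
    simp [Er]; norm_num
  rw [ENNReal.summable.tsum_sum ENNReal.summable, 
    ← evar_split g (by norm_num : (0:ℝ) ≤ 1/2) (by norm_num : (1/2:ℝ) ≤ 1)]
  exact add_le_add hl hr

theorem loI_hiI (i : ℕ ⊕ ℕ) : 0 ≤ loI i ∧ hiI i ≤ 1 := by
  rcases i with k | k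
  · have h1 := El_mem k
    have h2 := El_mem (k+1)
    simp only [El] at h1 h2
    push_cast at h2
    exact ⟨h2.1, h1.2⟩
  · have h1 := Er_mem k
    have h2 := Er_mem (k+1)
    simp only [Er] at h1 h2
    push_cast at h2
    exact ⟨h1.1, h2.2⟩

theorem exists_sys : ∃ l M U : ℕ ⊕ ℕ → ℝ,
    Sys (fun i => h (enum i)) (fun i x => |deriv (h (enum i)) x|) l M U := by
  choose l M U h1 h2 h3 h4 h5 h6 h7 h8 using fun i => (enum_branch i).bounds
  refine ⟨l, M, U, ⟨fun i x hx => ?_, h1, h2, h3, h4, h5, h6, h7, h8, fun g hg => ?_,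
    fun g V hg => ?_⟩⟩
  · have := (enum_branch i).maps x hx
    exact ⟨(loI_hiI i).1.trans this.1, this.2.trans (loI_hiI i).2⟩
  · simp only [(enum_branch _).int g]
    exact tile_int_all hg
  · have hle := (tile_var_all g).trans hg.2
    have hne : ∑' i, eVariationOn g (Icc (loI i) (hiI i)) ≠ ⊤ :=
      ne_top_of_le_ne_top ENNReal.ofReal_ne_top hle
    refine ⟨fun i => (eVariationOn g (Icc (loI i) (hiI i))).toReal, fun i => ?_,
      ENNReal.summable_toReal hne, ?_⟩
    · refine ⟨ENNReal.toReal_nonneg, ?_⟩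
      rw [(enum_branch i).var g, ENNReal.ofReal_toReal (ENNReal.ne_top_of_tsum_ne_top hne i)]
    · rw [← ENNReal.tsum_toReal_eq (fun i => ENNReal.ne_top_of_tsum_ne_top hne i)]
      exact ENNReal.toReal_le_of_le_ofReal hg.1 hle


theorem telescope_sum {α γ κ : ℝ} (hα : 0 < α) (hγ : 0 < γ) :
    HasSum (fun n : ℕ => κ / ((α * n + γ) * (α * (n + 1) + γ))) (κ / (α * γ)) := by
  have key : HasSum (fun n : ℕ => 1 / (α * n + γ) - 1 / (α * ((n + 1 : ℕ) : ℝ) + γ))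
      (1 / (α * ((0 : ℕ) : ℝ) + γ)) := by
    rw [hasSum_iff_tendsto_nat_of_nonneg]
    · have e : (fun n : ℕ => ∑ i ∈ Finset.range n,
          (1 / (α * (i : ℝ) + γ) - 1 / (α * ((i + 1 : ℕ) : ℝ) + γ))) =
          fun n : ℕ => 1 / (α * ((0 : ℕ) : ℝ) + γ) - 1 / (α * (n : ℝ) + γ) :=
        funext fun n => Finset.sum_range_sub' (fun i : ℕ => 1 / (α * (i : ℝ) + γ)) n
      rw [e]
      have h1 : Tendsto (fun n : ℕ => 1 / (α * (n : ℝ) + γ)) atTop (𝓝 0) :=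
        tendsto_const_nhds.div_atTop
          (tendsto_atTop_add_const_right _ _
            (tendsto_natCast_atTop_atTop.const_mul_atTop hα))
      have := (tendsto_const_nhds (x := 1 / (α * ((0 : ℕ) : ℝ) + γ))).sub h1
      rw [sub_zero] at this
      exact this
    · intro n
      rw [sub_nonneg]
      push_cast
      gcongr
      linarith
  have := key.mul_left (κ / α)
  have e : (fun n : ℕ => κ / ((α * n + γ) * (α * (n + 1) + γ))) =
      fun n : ℕ => κ / α * (1 / (α * (n:ℝ) + γ) - 1 / (α * ((n + 1 : ℕ) : ℝ) + γ)) := by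
    funext n
    have h1 : α * (n:ℝ) + γ ≠ 0 := by positivity
    have h2 : α * ((n:ℝ) + 1) + γ ≠ 0 := by positivity
    push_cast
    field_simp
    ring
  rw [e]
  have e3 : κ / (α * γ) = κ / α * (1 / (α * ((0 : ℕ) : ℝ) + γ)) := by
    rw [Nat.cast_zero, mul_zero, zero_add]
    field_simp
  rw [e3]
  exact this

theorem log_pos3 : 0 < Real.log (2 + Real.sqrt 3) :=
  Real.log_pos (by have := Real.sqrt_nonneg 3; linarith)

theorem sq3 : Real.sqrt 3 * Real.sqrt 3 = 3 := Real.mul_self_sqrt (by norm_num)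

theorem s3_lo : 1 < Real.sqrt 3 := by
  rw [Real.lt_sqrt] <;> norm_num

theorem s3_hi : Real.sqrt 3 < 2 := by
  rw [Real.sqrt_lt] <;> norm_num

theorem term_eq {φ : ℝ → ℝ} {p q r s x : ℝ} (hφ : ∀ x, φ x = (p*x+q)/(r*x+s))
    (hdet : |p*s-q*r| = 1) (hx : 0 < r*x+s) (hN : 0 ≤ p*x+q) (hND : p*x+q ≤ r*x+s) :
    |deriv φ x| * fdens (φ x) = 2 / Real.log (2 + Real.sqrt 3) /
      (((r*x+s) - (2 - Real.sqrt 3) * (p*x+q)) * ((r*x+s) + Real.sqrt 3 * (p*x+q))) := by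
  rw [mob_deriv hφ hdet hx.ne', hφ x, fdens]
  have hl := log_pos3
  have h1 := s3_lo
  have h2 := s3_hi
  generalize p*x+q = N at *
  generalize r*x+s = D at *
  have h3 : 0 < D - (2 - Real.sqrt 3) * N := by nlinarith
  have h4 : 0 < D + Real.sqrt 3 * N := by positivity
  have e1 : 1 - (2 - Real.sqrt 3) * (N / D) = (D - (2 - Real.sqrt 3) * N) / D := by
    field_simp
  have e2 : 1 + Real.sqrt 3 * (N / D) = (D + Real.sqrt 3 * N) / D := by
    field_simp
  rw [e1, e2]
  generalize D - (2 - Real.sqrt 3) * N = X at *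
  generalize D + Real.sqrt 3 * N = Y at *
  field_simp

theorem fdens_inv {x : ℝ} (hx : x ∈ Icc (0:ℝ) 1) : transferOp fdens x = fdens x := by
  obtain ⟨hx0, hx1⟩ := hx
  rw [transferOp_eq]
  refine HasSum.tsum_eq ?_
  have hl := log_pos3
  have h1 := s3_lo
  have h2 := s3_hi
  have h3 := sq3
  set w := Real.sqrt 3 with hw
  obtain ⟨c, hc⟩ : ∃ c, c = 2 / Real.log (2 + w) := ⟨_, rfl⟩
  have s0 : HasSum (fun n : ℕ => |deriv (h (enum (Sum.inl (2*n)))) x| *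
      fdens (h (enum (Sum.inl (2*n))) x)) (c / (2 * (x + w))) := by
    convert telescope_sum (κ := c) (two_pos) (by linarith : 0 < x + w) using 1
    funext n
    have hn : (0:ℝ) ≤ n := Nat.cast_nonneg n
    rw [term_eq (h_l0 n) (by norm_num) (by linarith) (by linarith) (by linarith), ← hw, ← hc]
    congr 2 <;> ring
  have s1 : HasSum (fun n : ℕ => |deriv (h (enum (Sum.inl (2*n+1)))) x| *
      fdens (h (enum (Sum.inl (2*n+1))) x)) (c / (2 * (2 - x + w))) := by
    convert telescope_sum (κ := c) (two_pos) (by linarith : 0 < 2 - x + w) using 1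
    funext n
    have hn : (0:ℝ) ≤ n := Nat.cast_nonneg n
    rw [term_eq (h_l1 n) (by norm_num) (by linarith) (by linarith) (by linarith), ← hw, ← hc]
    congr 2 <;> ring
  have hα : 0 < (1 + w) * (1 + x) := by positivity
  have hq : c / (2 - w) = c * (2 + w) := by
    rw [div_eq_iff (by linarith)]
    linear_combination c * h3
  have s2 : HasSum (fun n : ℕ => |deriv (h (enum (Sum.inr (2*n)))) x| *
      fdens (h (enum (Sum.inr (2*n))) x))
      (c * (2 + w) / ((1 + w) * (1 + x) * ((2 + w) * (1 + w * x)))) := by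
    convert telescope_sum (κ := c * (2 + w)) hα
      (by positivity : 0 < (2 + w) * (1 + w * x)) using 1
    funext n
    have hn : (0:ℝ) ≤ n := Nat.cast_nonneg n
    have hnx : (0:ℝ) ≤ n * x := by positivity
    rw [term_eq (h_r0 n) (by ring_nf; norm_num) (by nlinarith) (by nlinarith) (by nlinarith),
      ← hw, ← hc, ← hq, div_div]
    congr 1
    have e1 : ((n:ℝ)+3)*x+(n+2) - (2-w)*((n+2)*x+(n+1)) =
      (2-w)*((1 + w) * (1 + x) * (n+1) + (2 + w) * (1 + w * x)) := by
      linear_combination (2 + n + n*x + x + x*w) * h3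
    have e2 : ((n:ℝ)+3)*x+(n+2) + w*((n+2)*x+(n+1)) =
      (1 + w) * (1 + x) * n + (2 + w) * (1 + w * x) := by
      linear_combination (-x) * h3
    rw [e1, e2]
    ring
  have s3 : HasSum (fun n : ℕ => |deriv (h (enum (Sum.inr (2*n+1)))) x| *
      fdens (h (enum (Sum.inr (2*n+1))) x))
      (c * (2 + w) / ((1 + w) * (1 + x) * ((2 + w) * (x + w)))) := by
    convert telescope_sum (κ := c * (2 + w)) hα
      (by positivity : 0 < (2 + w) * (x + w)) using 1
    funext n
    have hn : (0:ℝ) ≤ n := Nat.cast_nonneg n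
    have hnx : (0:ℝ) ≤ n * x := by positivity
    rw [term_eq (h_r1 n) (by ring_nf; norm_num) (by nlinarith) (by nlinarith) (by nlinarith),
      ← hw, ← hc, ← hq, div_div]
    congr 1
    have e1 : ((n:ℝ)+2)*x+(n+3) - (2-w)*((n+1)*x+(n+2)) =
      (2-w)*((1 + w) * (1 + x) * (n+1) + (2 + w) * (x + w)) := by
      linear_combination (1 + n + n*x + 2*x + w) * h3
    have e2 : ((n:ℝ)+2)*x+(n+3) + w*((n+1)*x+(n+2)) =
      (1 + w) * (1 + x) * n + (2 + w) * (x + w) := by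
      linear_combination (-1) * h3
    rw [e1, e2]
    ring
  have sl := HasSum.even_add_odd (f := fun k => |deriv (h (enum (Sum.inl k))) x| *
      fdens (h (enum (Sum.inl k)) x)) s0 s1
  have sr := HasSum.even_add_odd (f := fun k => |deriv (h (enum (Sum.inr k))) x| *
      fdens (h (enum (Sum.inr k)) x)) s2 s3
  have := HasSum.sum_type (f := fun i => |deriv (h (enum i)) x| *
      fdens (h (enum i) x)) sl sr
  convert this using 1
  have e : fdens x = c * (2 + w) / ((2 + w - x) * (1 + w * x)) := by
    rw [← hq, fdens, ← hw, hc]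
    have : 1 - (2 - w) * x = (2 - w) * (2 + w - x) := by linear_combination h3
    rw [this]
    have a1 : 2 - w ≠ 0 := by linarith
    have a2 : 2 + w - x ≠ 0 := by linarith
    have a3 : 1 + w * x ≠ 0 := by positivity
    field_simp
  rw [e]
  have a2 : 2 + w - x ≠ 0 := by linarith
  have a2' : 2 - x + w ≠ 0 := by linarith
  have a3 : 1 + w * x ≠ 0 := by positivity
  have a4 : x + w ≠ 0 := by positivity
  have a5 : 1 + w ≠ 0 := by positivity
  have a6 : 1 + x ≠ 0 := by positivity
  have a7 : 2 + w ≠ 0 := by positivity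
  have e1 : c / (2 * (x + w)) + c / (2 * (2 - x + w)) =
      c * (1 + w) / ((x + w) * (2 + w - x)) := by
    field_simp
    ring
  have e2 : c * (2 + w) / ((1 + w) * (1 + x) * ((2 + w) * (1 + w * x))) +
      c * (2 + w) / ((1 + w) * (1 + x) * ((2 + w) * (x + w))) =
      c / ((1 + w * x) * (x + w)) := by
    field_simp
    ring
  rw [e1, e2]
  rw [div_add_div _ _ (by positivity) (by positivity), div_eq_div_iff (by positivity) (by positivity)]
  linear_combination (c*(x+w)*(2+w-x)*(1+w*x)*(1-x)) * h3

theorem fdens_split {x : ℝ} (hx : x ∈ Icc (0:ℝ) 1) :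
    fdens x = (Real.sqrt 3 / (1 + Real.sqrt 3 * x) +
      (2 - Real.sqrt 3) / (1 - (2 - Real.sqrt 3) * x)) * (1 / Real.log (2 + Real.sqrt 3)) := by
  obtain ⟨hx0, hx1⟩ := hx
  have hl := log_pos3
  have h1 := s3_lo
  have h2 := s3_hi
  rw [fdens]
  have a1 : 1 + Real.sqrt 3 * x ≠ 0 := by positivity
  have a2 : 1 - (2 - Real.sqrt 3) * x ≠ 0 := by nlinarith
  generalize Real.sqrt 3 = w at *
  field_simp
  ring

theorem fdens_var : ∃ V, VarLe fdens V := by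
  have h1 := s3_lo
  have h2 := s3_hi
  have v1 := VarLe.of_antitoneOn (f := fun x => Real.sqrt 3 / (1 + Real.sqrt 3 * x)) (by
    intro x hx y hy hxy
    have := hx.1
    dsimp only
    gcongr)
  have v2 := VarLe.of_monotoneOn
    (f := fun x => (2 - Real.sqrt 3) / (1 - (2 - Real.sqrt 3) * x)) (by
    intro x hx y hy hxy
    have := hy.2
    have h3 : 0 < 2 - Real.sqrt 3 := by linarith
    have h4 : 0 < 1 - (2 - Real.sqrt 3) * y := by nlinarith [hy.1]
    dsimp only
    gcongr)
  exact ⟨_, ((v1.add v2).const_mul (1 / Real.log (2 + Real.sqrt 3))).congr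
    fun x hx => fdens_split hx⟩

theorem fdens_int : ∫ x in Icc (0:ℝ) 1, fdens x = 1 := by
  have hl := log_pos3
  have h1 := s3_lo
  have h2 := s3_hi
  rw [integral_Icc_eq_integral_Ioc, ← intervalIntegral.integral_of_le zero_le_one]
  have hIntg : IntervalIntegrable fdens volume 0 1 := by
    obtain ⟨V, hV⟩ := fdens_var
    have := hV.integrableOn
    rw [← uIcc_of_le (zero_le_one)] at this
    exact this.intervalIntegrable
  rw [intervalIntegral.integral_eq_sub_of_hasDerivAt
    (f := fun x => (Real.log (1 + Real.sqrt 3 * x) - Real.log (1 - (2 - Real.sqrt 3) * x)) *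
      (1 / Real.log (2 + Real.sqrt 3))) _ hIntg]
  · have e : Real.log (1 + Real.sqrt 3 * 1) - Real.log (1 - (2 - Real.sqrt 3) * 1) =
        Real.log (2 + Real.sqrt 3) := by
      rw [← Real.log_div (by positivity) (by linarith)]
      congr 1
      rw [div_eq_iff (by linarith)]
      linear_combination (-1) * sq3
    simp only [e]
    simp only [mul_zero, add_zero, sub_zero, Real.log_one, zero_mul]
    field_simp
  · intro x hx
    rw [uIcc_of_le zero_le_one] at hx
    rw [fdens_split hx]
    obtain ⟨hx0, hx1⟩ := hx
    have a1 : 1 + Real.sqrt 3 * x ≠ 0 := by positivity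
    have a2 : 1 - (2 - Real.sqrt 3) * x ≠ 0 := by nlinarith
    have d1 : HasDerivAt (fun x => 1 + Real.sqrt 3 * x) (Real.sqrt 3) x := by
      simpa using ((hasDerivAt_id x).const_mul (Real.sqrt 3)).const_add 1
    have d2 : HasDerivAt (fun x => 1 - (2 - Real.sqrt 3) * x) (-(2 - Real.sqrt 3)) x := by
      simpa using ((hasDerivAt_id x).const_mul (2 - Real.sqrt 3)).const_sub 1
    refine (((d1.log a1).sub (d2.log a2)).mul_const (1 / Real.log (2 + Real.sqrt 3))).congr_deriv ?_
    rw [neg_div, sub_neg_eq_add]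


theorem transferOp_sub {l M U : ℕ ⊕ ℕ → ℝ}
    (S : Sys (fun i => h (enum i)) (fun i x => |deriv (h (enum i)) x|) l M U)
    {G : ℝ → ℝ} {I V : ℝ} (hr : VarLe (fun x => G x - fdens x * I) V) {x : ℝ}
    (hx : x ∈ Icc (0:ℝ) 1) :
    transferOp G x - fdens x * I =
      ∑' i, |deriv (h (enum i)) x| * (G (h (enum i) x) - fdens (h (enum i) x) * I) := by
  obtain ⟨Vf, hVf⟩ := fdens_var
  have s1 := S.summable_pt hr x hx
  have s2 := (S.summable_pt hVf x hx).mul_right I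
  have e2 : ∑' i, |deriv (h (enum i)) x| * fdens (h (enum i) x) * I = fdens x * I := by
    rw [tsum_mul_right, ← transferOp_eq, fdens_inv hx]
  have := s1.tsum_add s2
  rw [e2] at this
  rw [sub_eq_iff_eq_add, ← this, transferOp_eq]
  exact tsum_congr fun i => by ring

theorem iterate_bound {l M U : ℕ ⊕ ℕ → ℝ}
    (S : Sys (fun i => h (enum i)) (fun i x => |deriv (h (enum i)) x|) l M U)
    {g : ℝ → ℝ} {I V : ℝ} (hV : VarLe (fun x => g x - fdens x * I) V)
    (h0 : ∫ x in Icc (0:ℝ) 1, (g x - fdens x * I) = 0) (n : ℕ) :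
    ∃ W, VarLe (fun x => (transferOp^[n] g) x - fdens x * I) W ∧
      (∫ x in Icc (0:ℝ) 1, ((transferOp^[n] g) x - fdens x * I)) = 0 ∧
      6 * (∫ x in Icc (0:ℝ) 1, |(transferOp^[n] g) x - fdens x * I|) + W ≤
        (19/20) ^ n * (6 * (∫ x in Icc (0:ℝ) 1, |g x - fdens x * I|) + V) := by
  induction n with
  | zero => exact ⟨V, hV, h0, by simp⟩
  | succ n ih =>
    obtain ⟨W, hW, hi, hb⟩ := ih
    obtain ⟨W2, hW2, hb2⟩ := S.contract hW hi
    have e : ∀ x ∈ Icc (0:ℝ) 1, (transferOp^[n+1] g) x - fdens x * I =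
        ∑' i, |deriv (h (enum i)) x| *
          ((transferOp^[n] g) (h (enum i) x) - fdens (h (enum i) x) * I) := by
      intro x hx
      rw [Function.iterate_succ_apply']
      exact transferOp_sub S hW hx
    refine ⟨W2, hW2.congr e, ?_, ?_⟩
    · rw [setIntegral_congr_fun measurableSet_Icc e]
      exact (S.int_L hW).trans hi
    · rw [setIntegral_congr_fun measurableSet_Icc (fun x hx => congrArg abs (e x hx)), pow_succ']
      refine hb2.trans ?_
      rw [mul_assoc]
      exact mul_le_mul_of_nonneg_left hb (by norm_num)


/-- spectral gap of the transfer operator on BV: exponential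
convergence of `ℒⁿ g` to `f_μ ∫ g` in BV-norm, i.e. 1 is a simple dominant
eigenvalue with eigenfunction `f_μ`. -/
theorem transfer_operator_spectral_gap :
    ∃ C : ℝ, 0 < C ∧ ∃ θ : ℝ, θ ∈ Set.Ioo (0 : ℝ) 1 ∧
      ∀ g : ℝ → ℝ, BoundedVariationOn g (Set.Icc (0 : ℝ) 1) → ∀ n : ℕ, 1 ≤ n →
        (eVariationOn
            (fun x => (transferOp^[n] g) x - fdens x * ∫ t in Set.Icc (0 : ℝ) 1, g t)
            (Set.Icc (0 : ℝ) 1)).toReal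
          + ∫ x in Set.Icc (0 : ℝ) 1,
              |(transferOp^[n] g) x - fdens x * ∫ t in Set.Icc (0 : ℝ) 1, g t|
        ≤ C * θ ^ n *
            ((eVariationOn g (Set.Icc (0 : ℝ) 1)).toReal +
              ∫ x in Set.Icc (0 : ℝ) 1, |g x|) := by
  obtain ⟨l, M, U, S⟩ := exists_sys
  obtain ⟨Vf, hVf⟩ := fdens_var
  have hVf0 := hVf.nonneg
  have hF : 0 ≤ ∫ x in Icc (0:ℝ) 1, |fdens x| := integral_nonneg fun _ => abs_nonneg _
  set F := ∫ x in Icc (0:ℝ) 1, |fdens x| with hFdef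
  refine ⟨6 + 6 * F + Vf, by positivity, 19/20, ⟨by norm_num, by norm_num⟩, ?_⟩
  intro g hg n _
  have hgV := VarLe.of_bv hg
  set V := (eVariationOn g (Icc (0:ℝ) 1)).toReal with hVdef
  have hV0 := hgV.nonneg
  have hgi := hgV.integrableOn
  have hfi := hVf.integrableOn
  set I := ∫ t in Icc (0:ℝ) 1, g t with hI
  set N := ∫ t in Icc (0:ℝ) 1, |g t| with hN
  have hIN : |I| ≤ N := abs_integral_le_integral_abs
  have hI0 := abs_nonneg I
  have hd : VarLe (fun x => g x - fdens x * I) (V + Vf * |I|) := by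
    have := hgV.add (hVf.const_mul (-I))
    rw [abs_neg] at this
    exact this.congr fun x _ => by ring
  have hz : ∫ x in Icc (0:ℝ) 1, (g x - fdens x * I) = 0 := by
    rw [integral_sub hgi (hfi.mul_const I), integral_mul_const, fdens_int]
    simp [hI]
  have hd1 : ∫ x in Icc (0:ℝ) 1, |g x - fdens x * I| ≤ N + F * |I| := by
    rw [hN, hFdef, ← integral_mul_const, ← integral_add hgi.abs (hfi.abs.mul_const _)]
    refine integral_mono hd.integrableOn.abs (hgi.abs.add (hfi.abs.mul_const _)) fun x => ?_
    have := abs_sub (g x) (fdens x * I)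
    rw [abs_mul] at this
    exact this
  obtain ⟨W, hW, -, hb⟩ := iterate_bound S hd hz n
  have hn0 : 0 ≤ ∫ x in Icc (0:ℝ) 1, |(transferOp^[n] g) x - fdens x * I| :=
    integral_nonneg fun _ => abs_nonneg _
  have hWr := hW.toReal_le
  have hp : (0:ℝ) < (19/20)^n := by positivity
  have hfin : 6 * (∫ x in Icc (0:ℝ) 1, |g x - fdens x * I|) + (V + Vf * |I|) ≤
      (6 + 6 * F + Vf) * (V + N) := by
    nlinarith [mul_le_mul_of_nonneg_left hIN hF, mul_le_mul_of_nonneg_left hIN hVf0,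
      mul_nonneg hF hV0, mul_nonneg hVf0 hV0]
  have := mul_le_mul_of_nonneg_left hfin hp.le
  calc _ ≤ (19/20:ℝ)^n * ((6 + 6 * F + Vf) * (V + N)) := by linarith
    _ = _ := by ring

end SCF
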